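/- arXiv:1809.07646 — 6 statements merged into one kernel-verified Lean document; each statement's English description precedes it below -/
import Mathlib

section
/- Let S be a DNL-semiring with n(x) := ⨆{y ∈ S | x·y = 0}. Then n is an antitone involution on (S, ≤): a ≤ b implies n(b) ≤ n(a), and consequently n(n(x) + n(y)) equals the infimum x ∧ y of x and y in the complete lattice (S, ≤). -/
/-- The negation-like map of a semiring: `n x := ⨆ {y | x·y = 0}`. -/
def nsr {S : Type*} [Mul S] [Zero S] [SupSet S] (x : S) : S :=
  sSup {y : S | x * y = 0}

/-- In a DNL-semiring (a commutative idempotent simple semiring whose induced order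
`a ≤ b ↔ a + b = b` is a complete lattice order, with `n x := ⨆ {y | x·y = 0}`
satisfying (i) `n(n(x)) = x`, (ii) `x·n(x·n(y)) ≤ y`, (iii) `x·n(x+y) = 0`),
the map `n` is an antitone involution, and `n(n(x) + n(y))` is the infimum of
`x` and `y`. -/
theorem stmt_9 {S : Type*} [CommSemiring S] [CompleteLattice S]
    (hord : ∀ a b : S, a ≤ b ↔ a + b = b)
    (hidem : ∀ x : S, x + x = x)
    (hsimple : ∀ x : S, x + 1 = 1)
    (h1 : ∀ x : S, nsr (nsr x) = x)
    (h2 : ∀ x y : S, x * nsr (x * nsr y) ≤ y)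
    (h3 : ∀ x y : S, x * nsr (x + y) = 0) :
    (∀ a b : S, a ≤ b → nsr b ≤ nsr a) ∧
    (∀ x y : S, nsr (nsr x + nsr y) = x ⊓ y) := by
  have anti : ∀ a b : S, a ≤ b → nsr b ≤ nsr a := fun a b hab =>
    le_sSup (by simpa only [Set.mem_ofPred_eq, (hord a b).1 hab] using h3 a b)
  have le_add : ∀ a b : S, a ≤ a + b := fun a b =>
    (hord _ _).2 (by rw [← add_assoc, hidem])
  have add_le : ∀ a b c : S, a ≤ c → b ≤ c → a + b ≤ c := fun a b c ha hb =>
    (hord _ _).2 (by rw [add_assoc, (hord _ _).1 hb, (hord _ _).1 ha])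
  refine ⟨anti, fun x y => le_antisymm (le_inf ?_ ?_) ?_⟩
  · simpa only [h1] using anti _ _ (le_add (nsr x) (nsr y))
  · simpa only [h1, add_comm] using anti _ _ (le_add (nsr y) (nsr x))
  · simpa only [h1] using anti _ _
      (add_le _ _ _ (anti _ _ (inf_le_left : x ⊓ y ≤ x)) (anti _ _ (inf_le_right : x ⊓ y ≤ y)))
end

section
/- Let S be a DNL-semiring with n(x) := ⨆{y ∈ S | x·y = 0} and define a → b := n(a·n(b)). Then for all a, b ∈ S: a ≤ b if and only if a → b = 1. -/
/-- In a DNL-semiring, with `a → b := n(a·n(b))`, one has `a ≤ b ↔ a → b = 1`. -/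
theorem stmt_10 {S : Type*} [CommSemiring S] [CompleteLattice S]
    (hord : ∀ a b : S, a ≤ b ↔ a + b = b)
    (hidem : ∀ x : S, x + x = x)
    (hsimple : ∀ x : S, x + 1 = 1)
    (h1 : ∀ x : S, nsr (nsr x) = x)
    (h2 : ∀ x y : S, x * nsr (x * nsr y) ≤ y)
    (h3 : ∀ x y : S, x * nsr (x + y) = 0) :
    ∀ a b : S, a ≤ b ↔ nsr (a * nsr b) = 1 := by
  intro a b
  constructor
  · intro hab
    have hmul : a * nsr b = 0 := by
      have h := h3 a b
      rwa [(hord a b).1 hab] at h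
    rw [hmul]
    exact le_antisymm (sSup_le fun y _ => (hord y 1).2 (hsimple y)) (le_sSup (zero_mul 1))
  · intro h
    simpa only [h, mul_one] using h2 a b
end

section
/- Let S be a DNL-semiring with n(x) := ⨆{y ∈ S | x·y = 0}, and define x ∧ y := n(n(x) + n(y)) and x → y := n(x·n(y)). Then (S, +, ∧, ·, →, 0, 1) is a complete residuated lattice satisfying the double negation law; in particular, for all a, b, c ∈ S the adjointness a·b ≤ c if and only if a ≤ b → c holds, and ¬(¬a) = a where ¬a := a → 0. -/
/-- A DNL-semiring `S`, with `x ∧ y := n(n(x)+n(y))` and `x → y := n(x·n(y))`,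
is a complete residuated lattice satisfying the double negation law: `0` is the
bottom and `1` the top of the complete lattice, `n(n(x)+n(y))` is the infimum,
the adjointness property `a·b ≤ c ↔ a ≤ b → c` holds, and `¬¬a = a` where
`¬a := a → 0 = n(a·n(0))`. -/
theorem stmt_11 {S : Type*} [CommSemiring S] [CompleteLattice S]
    (hord : ∀ a b : S, a ≤ b ↔ a + b = b)
    (hidem : ∀ x : S, x + x = x)
    (hsimple : ∀ x : S, x + 1 = 1)
    (h1 : ∀ x : S, nsr (nsr x) = x)
    (h2 : ∀ x y : S, x * nsr (x * nsr y) ≤ y)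
    (h3 : ∀ x y : S, x * nsr (x + y) = 0) :
    (⊥ : S) = 0 ∧ (⊤ : S) = 1 ∧
    (∀ x y : S, nsr (nsr x + nsr y) = x ⊓ y) ∧
    (∀ a b c : S, a * b ≤ c ↔ a ≤ nsr (b * nsr c)) ∧
    (∀ a : S, nsr (nsr (a * nsr 0) * nsr 0) = a) := by
  have hmul : ∀ {x y : S} (z : S), x ≤ y → x * z ≤ y * z := fun z h => by
    rw [hord] at h ⊢
    rw [← add_mul, h]
  have hzero : ∀ x : S, 0 ≤ x := fun x => (hord _ _).2 (zero_add x)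
  have hone : ∀ x : S, x ≤ 1 := fun x => (hord _ _).2 (hsimple x)
  have hself : ∀ x : S, x * nsr x = 0 := fun x => by simpa only [hidem] using h3 x x
  have hiff : ∀ x z : S, x * z = 0 ↔ z ≤ nsr x := fun x z => by
    refine ⟨fun h => le_sSup h, fun h => le_antisymm ?_ (hzero _)⟩
    have := hmul x h
    rwa [mul_comm (nsr x), hself, mul_comm] at this
  have hanti : ∀ {x y : S}, x ≤ y → nsr y ≤ nsr x := fun {x y} h => by
    rw [← hiff]
    exact le_antisymm ((hmul _ h).trans_eq (hself y)) (hzero _)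
  have hn0 : nsr (0 : S) = 1 := le_antisymm (hone _) ((hiff _ _).1 (zero_mul _))
  refine ⟨le_antisymm bot_le (hzero _), le_antisymm (hone _) le_top, fun x y => ?_,
    fun a b c => ?_, fun a => ?_⟩
  · apply le_antisymm
    · refine le_inf ((hanti ?_).trans_eq (h1 x)) ((hanti ?_).trans_eq (h1 y))
      · rw [hord, ← add_assoc, hidem]
      · rw [hord, add_left_comm, hidem]
    · rw [← h1 (x ⊓ y)]
      apply hanti
      rw [hord, add_assoc, (hord _ _).1 (hanti inf_le_right), (hord _ _).1 (hanti inf_le_left)]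
  · rw [← hiff, mul_comm b, mul_assoc, hiff, h1, mul_comm b]
  · rw [hn0, mul_one, mul_one, h1]
end

section
/- Let L be a complete residuated lattice satisfying the double negation law, and define n(a) := ⨆{x ∈ L | a ⊙ x = 0}. Then n(a) = ¬a for all a, and (L, ∨, ⊙, 0, 1) is a DNL-semiring; concretely, for all x, y ∈ L: n(n(x)) = x, x ⊙ n(x ⊙ n(y)) ≤ y, and x ⊙ n(x ∨ y) = 0. -/
/-- A complete residuated lattice: a complete lattice (with `⊥` playing the role of
`0` and `⊤` the role of `1`) together with a commutative monoid operation `mul` with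
unit `⊤` satisfying the adjointness property. -/
class CompleteResiduatedLattice (L : Type*) extends CompleteLattice L where
  mul : L → L → L
  mul_assoc : ∀ x y z : L, mul (mul x y) z = mul x (mul y z)
  mul_comm : ∀ x y : L, mul x y = mul y x
  mul_top : ∀ x : L, mul x ⊤ = x
  himp : L → L → L
  adjoint : ∀ x y z : L, mul x y ≤ z ↔ x ≤ himp y z

open CompleteResiduatedLattice

/-- `n a := ⨆ {x | a ⊙ x = 0}`. -/
def nres {L : Type*} [CompleteResiduatedLattice L] (a : L) : L :=
  sSup {x : L | mul a x = ⊥}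

theorem mul_eq_bot_iff_le_himp_bot {L : Type*} [CompleteResiduatedLattice L] (a x : L) :
    mul a x = ⊥ ↔ x ≤ CompleteResiduatedLattice.himp a ⊥ := by
  rw [CompleteResiduatedLattice.mul_comm, ← le_bot_iff, adjoint]

theorem nres_eq_himp_bot {L : Type*} [CompleteResiduatedLattice L] (a : L) :
    nres a = CompleteResiduatedLattice.himp a ⊥ :=
  le_antisymm (sSup_le fun x hx => (mul_eq_bot_iff_le_himp_bot a x).1 hx)
    (le_sSup ((mul_eq_bot_iff_le_himp_bot a _).2 le_rfl))

theorem mul_eq_bot_iff_le_nres {L : Type*} [CompleteResiduatedLattice L] (a x : L) :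
    mul a x = ⊥ ↔ x ≤ nres a := by
  rw [nres_eq_himp_bot, mul_eq_bot_iff_le_himp_bot]

theorem mul_nres_self {L : Type*} [CompleteResiduatedLattice L] (a : L) :
    mul a (nres a) = ⊥ :=
  (mul_eq_bot_iff_le_nres a _).2 le_rfl

/-- For a complete residuated lattice satisfying the double negation law,
`n(a) = ¬a` and the reduct `(L, ∨, ⊙, 0, 1)` is a DNL-semiring: `n(n(x)) = x`,
`x ⊙ n(x ⊙ n(y)) ≤ y` and `x ⊙ n(x ∨ y) = 0`
(it is a commutative idempotent simple semiring by the analogue of Theorem 1). -/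
theorem stmt_12 {L : Type*} [CompleteResiduatedLattice L]
    (hdnl : ∀ x : L, himp (himp x ⊥) ⊥ = x) :
    (∀ a : L, nres a = himp a ⊥) ∧
    (∀ x : L, nres (nres x) = x) ∧
    (∀ x y : L, mul x (nres (mul x (nres y))) ≤ y) ∧
    (∀ x y : L, mul x (nres (x ⊔ y)) = ⊥) := by
  have hn : ∀ x : L, nres (nres x) = x := fun x => by
    rw [nres_eq_himp_bot, nres_eq_himp_bot, hdnl]
  refine ⟨nres_eq_himp_bot, hn, fun x y => ?_, fun x y => ?_⟩
  · have h : mul (nres y) (mul x (nres (mul x (nres y)))) = ⊥ := by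
      rw [← CompleteResiduatedLattice.mul_assoc, CompleteResiduatedLattice.mul_comm (nres y) x]
      exact mul_nres_self _
    rwa [mul_eq_bot_iff_le_nres, hn] at h
  · rw [← le_bot_iff, adjoint]
    refine le_sup_left.trans ((adjoint (x ⊔ y) _ _).1 ?_)
    exact (mul_nres_self _).le
end

section
/- Let L be a residuated lattice satisfying the double negation law (¬(¬x) = x where ¬x := x → 0). Then L is idempotent (x ⊙ x = x for all x) if and only if (L, ∨, ∧, ¬, 0, 1) is a Boolean algebra; in particular, if L is idempotent then the lattice (L, ∨, ∧) is distributive and for every a ∈ L one has a ∧ ¬a = 0 and a ∨ ¬a = 1. -/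
/-- A residuated lattice: a bounded lattice (with `⊥` playing the role of `0` and
`⊤` the role of `1`) together with a commutative monoid operation `mul` with unit `⊤`
satisfying the adjointness property. -/
class ResiduatedLattice (L : Type*) extends Lattice L, BoundedOrder L where
  mul : L → L → L
  mul_assoc : ∀ x y z : L, mul (mul x y) z = mul x (mul y z)
  mul_comm : ∀ x y : L, mul x y = mul y x
  mul_top : ∀ x : L, mul x ⊤ = x
  himp : L → L → L
  adjoint : ∀ x y z : L, mul x y ≤ z ↔ x ≤ himp y z

open ResiduatedLattice

namespace ResiduatedLattice

variable {L : Type*} [ResiduatedLattice L]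

theorem mul_mono_left {x y : L} (h : x ≤ y) (z : L) : mul x z ≤ mul y z :=
  (adjoint _ _ _).2 (h.trans ((adjoint _ _ _).1 le_rfl))

theorem mul_mono {x y z w : L} (h : x ≤ y) (h' : z ≤ w) : mul x z ≤ mul y w := by
  refine (mul_mono_left h z).trans ?_
  rw [ResiduatedLattice.mul_comm y z, ResiduatedLattice.mul_comm y w]
  exact mul_mono_left h' y

theorem mul_le_inf (x y : L) : mul x y ≤ x ⊓ y := by
  refine le_inf ?_ ?_
  · exact (mul_mono le_rfl le_top).trans_eq (ResiduatedLattice.mul_top x)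
  · rw [ResiduatedLattice.mul_comm]
    exact (mul_mono le_rfl le_top).trans_eq (ResiduatedLattice.mul_top y)

theorem mul_eq_inf_of_idempotent (h : ∀ x : L, mul x x = x) (x y : L) : mul x y = x ⊓ y :=
  (mul_le_inf x y).antisymm ((h _).ge.trans (mul_mono inf_le_left inf_le_right))

theorem himp_mul_le (x y : L) : mul (himp x y) x ≤ y :=
  (adjoint _ _ _).2 le_rfl

theorem himp_antitone_left {x y : L} (h : x ≤ y) (z : L) : himp y z ≤ himp x z :=
  (adjoint _ _ _).1 ((mul_mono le_rfl h).trans (himp_mul_le y z))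

theorem inf_sup_eq_of_idempotent (h : ∀ x : L, mul x x = x) (a b c : L) :
    a ⊓ (b ⊔ c) = (a ⊓ b) ⊔ (a ⊓ c) := by
  refine le_antisymm ?_ le_inf_sup
  rw [inf_comm, ← mul_eq_inf_of_idempotent h, adjoint]
  refine sup_le ?_ ?_ <;> rw [← adjoint, mul_eq_inf_of_idempotent h, inf_comm]
  · exact le_sup_left
  · exact le_sup_right

theorem inf_himp_bot_of_idempotent (h : ∀ x : L, mul x x = x) (a : L) :
    a ⊓ himp a ⊥ = ⊥ := by
  rw [inf_comm, ← mul_eq_inf_of_idempotent h]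
  exact le_bot_iff.1 (himp_mul_le a ⊥)

theorem sup_himp_bot_of_idempotent (hdnl : ∀ x : L, himp (himp x ⊥) ⊥ = x)
    (h : ∀ x : L, mul x x = x) (a : L) : a ⊔ himp a ⊥ = ⊤ := by
  have hneg : himp (a ⊔ himp a ⊥) ⊥ = ⊥ := by
    refine le_bot_iff.1 (le_trans ?_ (inf_himp_bot_of_idempotent h (himp a ⊥)).le)
    exact le_inf (himp_antitone_left le_sup_left _) (himp_antitone_left le_sup_right _)
  rw [← hdnl (a ⊔ himp a ⊥), hneg, ← top_le_iff, ← adjoint]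
  exact (mul_le_inf _ _).trans inf_le_right

theorem mul_self_of_sup_himp_bot {x : L} (h : x ⊔ himp x ⊥ = ⊤) : mul x x = x := by
  refine le_antisymm ((mul_le_inf x x).trans inf_le_left) ?_
  have htop : ⊤ ≤ himp x (mul x x) := by
    rw [← h]
    exact sup_le ((adjoint _ _ _).1 le_rfl)
      ((adjoint _ _ _).1 ((himp_mul_le x ⊥).trans bot_le))
  rwa [← adjoint, ResiduatedLattice.mul_comm, ResiduatedLattice.mul_top] at htop

end ResiduatedLattice

/-- A residuated lattice satisfying the double negation law (`¬¬x = x` where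
`¬x := x → 0`) is idempotent iff `(L, ∨, ∧, ¬, 0, 1)` is a Boolean algebra,
i.e. iff the lattice is distributive and `¬a` is a complement of `a`:
`a ∧ ¬a = 0` and `a ∨ ¬a = 1` for all `a`. -/
theorem stmt_15 {L : Type*} [ResiduatedLattice L]
    (hdnl : ∀ x : L, himp (himp x ⊥) ⊥ = x) :
    (∀ x : L, mul x x = x) ↔
      ((∀ a b c : L, a ⊓ (b ⊔ c) = (a ⊓ b) ⊔ (a ⊓ c)) ∧
       (∀ a : L, a ⊓ himp a ⊥ = ⊥) ∧
       (∀ a : L, a ⊔ himp a ⊥ = ⊤)) := by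
  constructor
  · intro h
    exact ⟨inf_sup_eq_of_idempotent h, inf_himp_bot_of_idempotent h,
      sup_himp_bot_of_idempotent hdnl h⟩
  · rintro ⟨-, -, h⟩ x
    exact mul_self_of_sup_himp_bot (h x)
end

section
/- Let S be a DNL-semiring with n(x) := ⨆{y ∈ S | x·y = 0}, and let L(S) = (S, ∨, ∧, ·, →, 0, 1) be the associated complete residuated lattice with x ∨ y = x + y, x ∧ y = n(n(x) + n(y)) and x → y = n(x·n(y)). Then L(S) is prelinear, i.e., (x → y) ∨ (y → x) = 1 for all x, y, if and only if S satisfies the identity x·n(n(y) + n(z)) = n(n(x·y) + n(x·z)) for all x, y, z ∈ S. -/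
/-- For a DNL-semiring `S`, the associated complete residuated lattice
(with `x ∨ y = x + y`, `x ∧ y = n(n(x)+n(y))`, `x → y = n(x·n(y))`) is
prelinear, i.e. `(x → y) ∨ (y → x) = 1`, if and only if `S` satisfies the
identity `x·n(n(y)+n(z)) = n(n(x·y)+n(x·z))`. -/
theorem stmt_16 {S : Type*} [CommSemiring S] [CompleteLattice S]
    (hord : ∀ a b : S, a ≤ b ↔ a + b = b)
    (hidem : ∀ x : S, x + x = x)
    (hsimple : ∀ x : S, x + 1 = 1)
    (h1 : ∀ x : S, nsr (nsr x) = x)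
    (h2 : ∀ x y : S, x * nsr (x * nsr y) ≤ y)
    (h3 : ∀ x y : S, x * nsr (x + y) = 0) :
    (∀ x y : S, nsr (x * nsr y) + nsr (y * nsr x) = 1) ↔
    (∀ x y z : S, x * nsr (nsr y + nsr z) = nsr (nsr (x * y) + nsr (x * z))) := by
  have zero_le' (a : S) : 0 ≤ a := (hord _ _).2 (zero_add a)
  have le_one' (a : S) : a ≤ 1 := (hord _ _).2 (hsimple a)
  have eq_zero_of_le {a : S} (h : a ≤ 0) : a = 0 := le_antisymm h (zero_le' a)
  have le_add_left' (a b : S) : a ≤ a + b := (hord _ _).2 (by rw [← add_assoc, hidem])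
  have le_add_right' (a b : S) : b ≤ a + b := add_comm b a ▸ le_add_left' b a
  have add_le' {a b c : S} (ha : a ≤ c) (hb : b ≤ c) : a + b ≤ c :=
    (hord _ _).2 (by rw [add_assoc, (hord _ _).1 hb, (hord _ _).1 ha])
  have mul_mono (a : S) {b c : S} (h : b ≤ c) : a * b ≤ a * c :=
    (hord _ _).2 (by rw [← mul_add, (hord _ _).1 h])
  have mul_nsr (a : S) : a * nsr a = 0 := by simpa using h3 a 0
  have mul_eq_zero_iff (a b : S) : a * b = 0 ↔ b ≤ nsr a :=
    ⟨fun h => le_sSup h, fun h => eq_zero_of_le (mul_nsr a ▸ mul_mono a h)⟩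
  have le_nsr_comm {a b : S} (h : a ≤ nsr b) : b ≤ nsr a := by
    rwa [← mul_eq_zero_iff, mul_comm, mul_eq_zero_iff]
  have nsr_anti {a b : S} (h : a ≤ b) : nsr b ≤ nsr a :=
    le_nsr_comm (by rwa [h1])
  have nsr_zero : nsr (0 : S) = 1 :=
    le_antisymm (le_one' _) ((mul_eq_zero_iff _ _).1 (zero_mul 1))
  have inf_le_left' (a b : S) : nsr (nsr a + nsr b) ≤ a :=
    (nsr_anti (le_add_left' _ _)).trans_eq (h1 a)
  have inf_le_right' (a b : S) : nsr (nsr a + nsr b) ≤ b :=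
    (nsr_anti (le_add_right' _ _)).trans_eq (h1 b)
  have le_inf' {a b c : S} (ha : c ≤ a) (hb : c ≤ b) : c ≤ nsr (nsr a + nsr b) :=
    le_nsr_comm (add_le' (nsr_anti ha) (nsr_anti hb))
  have mul_le_self (a b : S) : a * b ≤ a := (mul_mono a (le_one' b)).trans_eq (mul_one a)
  constructor
  · intro hpre x y z
    refine le_antisymm
      (le_inf' (mul_mono x (inf_le_left' y z)) (mul_mono x (inf_le_right' y z))) ?_
    set m := nsr (nsr (x * y) + nsr (x * z))
    have bound {u v w : S} (hu : m ≤ x * u)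
        (hw : u * nsr (u * nsr v) ≤ w) : m * nsr (u * nsr v) ≤ x * w := by
      rw [mul_comm]
      refine (mul_mono _ hu).trans ?_
      rw [mul_comm, mul_assoc]
      exact mul_mono x hw
    rw [← mul_one m, ← hpre y z, mul_add]
    exact add_le' (bound (inf_le_left' _ _) (le_inf' (mul_le_self _ _) (h2 y z)))
      (bound (inf_le_right' _ _) (le_inf' (h2 z y) (mul_le_self _ _)))
  · intro hdist x y
    have h := hdist (x + y) (nsr x) (nsr y)
    rw [h1, h1, mul_nsr, add_mul, add_mul, mul_nsr, mul_nsr, zero_add, add_zero] at h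
    rw [add_comm, ← h1 (nsr (y * nsr x) + nsr (x * nsr y)), ← h, nsr_zero]
end
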